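/- Uniqueness of the Shapley value: let ψ be any map assigning to each cooperative game φ on N an allocation ψ(φ) : N → ℝ, and suppose ψ satisfies (1) efficiency: Σ_{i∈N} ψ_i(φ) = φ(N) − φ(∅) for every game φ; (2) symmetry: whenever φ(S ∪ {i}) = φ(S ∪ {j}) for every coalition S ⊆ N \ {i, j}, then ψ_i(φ) = ψ_j(φ); (3) dummy player: whenever φ(S ∪ {i}) − φ(S) = φ({i}) − φ(∅) for every coalition S ⊆ N \ {i}, then ψ_i(φ) = φ({i}) − φ(∅); and (4) additivity: ψ_i(φ + ψ') = ψ_i(φ) + ψ_i(ψ') for all games φ, ψ' and all i ∈ N. Then ψ coincides with the Shapley value: ψ_i(φ) = π_i(φ) for every game φ and every player i ∈ N. -/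

import Mathlib

open scoped BigOperators

/-- The Shapley value of player `i` in the cooperative game `φ` on the finite
player set `α`: `π_i(φ) = ∑_{S ⊆ N \ {i}} (|S|! (|N| − |S| − 1)! / |N|!) (φ(S ∪ {i}) − φ(S))`. -/
noncomputable def shapleyValue {α : Type*} [Fintype α] [DecidableEq α]
    (φ : Finset α → ℝ) (i : α) : ℝ :=
  ∑ S ∈ (Finset.univ.erase i).powerset,
    ((Nat.factorial S.card * Nat.factorial (Fintype.card α - S.card - 1) : ℝ) /
        (Nat.factorial (Fintype.card α) : ℝ)) *
      (φ (insert i S) - φ S)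

section ShapleyValue

variable {α : Type*} [Fintype α] [DecidableEq α]

lemma shapleyValue_add (φ φ' : Finset α → ℝ) (i : α) :
    shapleyValue (fun S => φ S + φ' S) i = shapleyValue φ i + shapleyValue φ' i := by
  simp only [shapleyValue, ← Finset.sum_add_distrib]
  exact Finset.sum_congr rfl fun S _ => by ring

/-- A player whose marginal contributions all vanish has Shapley value zero. -/
lemma shapleyValue_eq_zero (φ : Finset α → ℝ) (i : α)
    (h : ∀ S ⊆ Finset.univ.erase i, φ (insert i S) - φ S = 0) : shapleyValue φ i = 0 :=
  Finset.sum_eq_zero fun S hS => by rw [h S (Finset.mem_powerset.mp hS), mul_zero]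

/-- Interchangeable players have the same Shapley value. -/
lemma shapleyValue_symm (φ : Finset α → ℝ) (i j : α)
    (h : ∀ S ⊆ Finset.univ \ ({i, j} : Finset α), φ (insert i S) = φ (insert j S)) :
    shapleyValue φ i = shapleyValue φ j := by
  rcases eq_or_ne i j with rfl | hij
  · rfl
  have hi : Finset.univ.erase i = insert j (Finset.univ \ ({i, j} : Finset α)) := by
    ext x; simp; grind
  have hj : Finset.univ.erase j = insert i (Finset.univ \ ({i, j} : Finset α)) := by
    ext x; simp; grind
  unfold shapleyValue
  rw [hi, hj, Finset.sum_powerset_insert (by simp), Finset.sum_powerset_insert (by simp)]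
  congr 1
  · refine Finset.sum_congr rfl fun S hS => ?_
    rw [h S (Finset.mem_powerset.mp hS)]
  · refine Finset.sum_congr rfl fun S hS => ?_
    have hS' := Finset.mem_powerset.mp hS
    have hiS : i ∉ S := fun hm => by simpa using hS' hm
    have hjS : j ∉ S := fun hm => by simpa using hS' hm
    rw [h S hS', Finset.insert_comm, Finset.card_insert_of_notMem hiS,
      Finset.card_insert_of_notMem hjS]

/-- The Shapley value is efficient. -/
lemma sum_shapleyValue [Nonempty α] (φ : Finset α → ℝ) :
    ∑ i, shapleyValue φ i = φ Finset.univ - φ ∅ := by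
  set n := Fintype.card α with hn
  let w : ℕ → ℝ := fun k => (k.factorial * (n - k - 1).factorial : ℝ) / n.factorial
  let v : ℕ → ℝ := fun k => (k.factorial * (n - k).factorial : ℝ) / n.factorial
  have hw : ∀ k : ℕ, (k + 1) * w k = v (k + 1) := by
    intro k
    simp only [w, v, Nat.factorial_succ, Nat.sub_sub]
    push_cast
    ring
  have hw' : ∀ k, k < n → ((n - k : ℕ) : ℝ) * w k = v k := by
    intro k hk
    obtain ⟨m, hm⟩ : ∃ m, n - k = m + 1 := ⟨n - k - 1, by omega⟩
    simp only [w, v, hm, Nat.factorial_succ, Nat.add_sub_cancel]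
    push_cast
    ring
  have hfactor : (n.factorial : ℝ) ≠ 0 := by positivity
  have hjoin : ∀ i : α, ∑ S ∈ (Finset.univ.erase i).powerset, w S.card * φ (insert i S) =
      ∑ T : Finset α, if i ∈ T then w (T.card - 1) * φ T else 0 := by
    intro i
    rw [← Finset.sum_filter]
    refine Finset.sum_nbij' (insert i) (fun T => T.erase i) ?_ ?_ ?_ ?_ ?_
    · intro S _; simp
    · intro T _; simpa using Finset.erase_subset_erase i (Finset.subset_univ T)
    · intro S hS
      exact Finset.erase_insert fun hm => by simpa using Finset.mem_powerset.mp hS hm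
    · intro T hT; exact Finset.insert_erase (by simpa using hT)
    · intro S hS
      rw [Finset.card_insert_of_notMem fun hm => by simpa using Finset.mem_powerset.mp hS hm,
        Nat.add_sub_cancel]
  have hleave : ∀ i : α, ∑ S ∈ (Finset.univ.erase i).powerset, w S.card * φ S =
      ∑ T : Finset α, if i ∈ T then 0 else w T.card * φ T := by
    intro i
    simp_rw [← ite_not (p := i ∈ _)]
    rw [← Finset.sum_filter]
    refine Finset.sum_congr ?_ fun _ _ => rfl
    ext S
    simp [Finset.subset_erase]
  have hsplit : ∀ i : α, shapleyValue φ i =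
      ∑ T : Finset α, ((if i ∈ T then w (T.card - 1) * φ T else 0) -
        if i ∈ T then 0 else w T.card * φ T) := by
    intro i
    rw [Finset.sum_sub_distrib, ← hjoin, ← hleave, ← Finset.sum_sub_distrib]
    exact Finset.sum_congr rfl fun S _ => mul_sub _ _ _
  have hcoeff : ∀ T : Finset α, ∑ i, ((if i ∈ T then w (T.card - 1) * φ T else 0) -
      if i ∈ T then 0 else w T.card * φ T) =
      (if T = Finset.univ then φ T else 0) - if T = ∅ then φ T else 0 := by
    intro T
    have hplus : ∑ i, (if i ∈ T then w (T.card - 1) * φ T else 0) =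
        (if T = ∅ then 0 else v T.card) * φ T := by
      rw [← Finset.sum_filter, Finset.sum_const, nsmul_eq_mul, Finset.filter_univ_mem]
      split_ifs with h
      · simp [h]
      · obtain ⟨k, hk⟩ := Nat.exists_eq_add_one.mpr
          (Finset.card_pos.mpr (Finset.nonempty_iff_ne_empty.mpr h))
        rw [hk, Nat.add_sub_cancel, ← hw k]
        push_cast
        ring
    have hminus : ∑ i, (if i ∈ T then 0 else w T.card * φ T) =
        (if T = Finset.univ then 0 else v T.card) * φ T := by
      simp_rw [← ite_not (p := _ ∈ T)]
      rw [← Finset.sum_filter, Finset.sum_const, nsmul_eq_mul, Finset.filter_not,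
        Finset.filter_univ_mem, ← Finset.compl_eq_univ_sdiff, Finset.card_compl]
      split_ifs with h
      · simp [h]
      · rw [← hw' T.card ((Finset.card_lt_iff_ne_univ T).mpr h)]
        ring
    rw [Finset.sum_sub_distrib, hplus, hminus]
    by_cases h0 : T = ∅
    · subst h0
      simp [v, Finset.univ_nonempty.ne_empty.symm, hfactor]
    · by_cases h1 : T = Finset.univ
      · subst h1
        simp [v, h0, hfactor, ← hn]
      · simp [h0, h1]
  simp_rw [hsplit]
  rw [Finset.sum_comm]
  simp_rw [hcoeff]
  simp

end ShapleyValue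

/-- Every cooperative game is a linear combination of unanimity games. -/
lemma exists_eq_sum_unanimity {α : Type*} [Fintype α] [DecidableEq α] (φ : Finset α → ℝ) :
    ∃ c : Finset α → ℝ, φ = fun S => ∑ T, if T ⊆ S then c T else 0 := by
  let F : ∀ T : Finset α, (∀ U ⊂ T, ℝ) → ℝ := fun T ih =>
    φ T - ∑ U ∈ T.ssubsets.attach, ih U.1 (Finset.mem_ssubsets.mp U.2)
  refine ⟨Finset.strongInduction F, funext fun S => ?_⟩
  have hS : Finset.univ.filter (· ⊆ S) = insert S S.ssubsets := by
    ext T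
    simp [Finset.mem_ssubsets, ← le_iff_eq_or_lt]
  rw [← Finset.sum_filter, hS, Finset.sum_insert (by simp [Finset.mem_ssubsets]),
    Finset.strongInduction_eq]
  simp only [F]
  rw [Finset.sum_attach S.ssubsets (fun U => Finset.strongInduction F U), sub_add_cancel]

/-- Two allocations with equal totals that are constant on `T` and vanish off `T` agree. -/
lemma eq_of_sum_eq_of_const_on {α : Type*} [Fintype α] [DecidableEq α] {T : Finset α}
    {a b : α → ℝ}
    (hsum : ∑ i, a i = ∑ i, b i) (ha : ∀ i ∉ T, a i = 0) (hb : ∀ i ∉ T, b i = 0)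
    (ha' : ∀ i ∈ T, ∀ j ∈ T, a i = a j) (hb' : ∀ i ∈ T, ∀ j ∈ T, b i = b j) : a = b := by
  funext i
  by_cases hi : i ∈ T
  · rw [← Finset.sum_subset (Finset.subset_univ T) fun j _ hj => ha j hj,
      ← Finset.sum_subset (Finset.subset_univ T) fun j _ hj => hb j hj,
      Finset.sum_congr rfl fun j hj => ha' j hj i hi,
      Finset.sum_congr rfl fun j hj => hb' j hj i hi, Finset.sum_const, Finset.sum_const,
      nsmul_eq_mul, nsmul_eq_mul] at hsum
    exact mul_left_cancel₀ (Nat.cast_ne_zero.mpr (Finset.card_ne_zero_of_mem hi)) hsum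
  · rw [ha i hi, hb i hi]

/-- Uniqueness of the Shapley value: any allocation rule `ψ` satisfying efficiency,
symmetry, the dummy-player property, and additivity coincides with the Shapley value. -/
theorem shapley_uniqueness {α : Type*} [Fintype α] [DecidableEq α] [Nonempty α]
    (ψ : (Finset α → ℝ) → α → ℝ)
    (heff : ∀ φ : Finset α → ℝ, ∑ i, ψ φ i = φ Finset.univ - φ ∅)
    (hsym : ∀ (φ : Finset α → ℝ) (i j : α),
      (∀ S ⊆ Finset.univ \ ({i, j} : Finset α), φ (insert i S) = φ (insert j S)) →
      ψ φ i = ψ φ j)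
    (hdummy : ∀ (φ : Finset α → ℝ) (i : α),
      (∀ S ⊆ Finset.univ.erase i, φ (insert i S) - φ S = φ {i} - φ ∅) →
      ψ φ i = φ {i} - φ ∅)
    (hadd : ∀ (φ φ' : Finset α → ℝ) (i : α),
      ψ (fun S => φ S + φ' S) i = ψ φ i + ψ φ' i) :
    ∀ (φ : Finset α → ℝ) (i : α), ψ φ i = shapleyValue φ i := by
  have hunanimity : ∀ (T : Finset α) (c : ℝ),
      ψ (fun S => if T ⊆ S then c else 0) = shapleyValue fun S => if T ⊆ S then c else 0 := by
    intro T c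
    set u : Finset α → ℝ := fun S => if T ⊆ S then c else 0 with hu
    have hnull : ∀ i ∉ T, ∀ S, u (insert i S) - u S = 0 := by
      intro i hi S
      simp [hu, Finset.subset_insert_iff_of_notMem hi]
    have hswap : ∀ i ∈ T, ∀ j ∈ T, ∀ S ⊆ Finset.univ \ ({i, j} : Finset α),
        u (insert i S) = u (insert j S) := by
      intro i hi j hj S hS
      rcases eq_or_ne i j with rfl | hij
      · rfl
      have hiS : i ∉ S := fun hm => by simpa using hS hm
      have hjS : j ∉ S := fun hm => by simpa using hS hm
      have h1 : ¬T ⊆ insert i S := fun h => by simpa [hij.symm, hjS] using h hj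
      have h2 : ¬T ⊆ insert j S := fun h => by simpa [hij, hiS] using h hi
      simp [hu, h1, h2]
    refine eq_of_sum_eq_of_const_on (T := T) ((heff u).trans (sum_shapleyValue u).symm)
      (fun i hi => ?_) (fun i hi => shapleyValue_eq_zero u i fun S _ => hnull i hi S)
      (fun i hi j hj => hsym u i j (hswap i hi j hj))
      (fun i hi j hj => shapleyValue_symm u i j (hswap i hi j hj))
    have h0 : u {i} - u ∅ = 0 := hnull i hi ∅
    rw [hdummy u i fun S _ => (hnull i hi S).trans h0.symm, h0]
  intro φ i
  obtain ⟨c, rfl⟩ := exists_eq_sum_unanimity φ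
  induction (Finset.univ : Finset (Finset α)) using Finset.induction_on with
  | empty => simpa using congrFun (hunanimity ∅ 0) i
  | insert T s hT ih =>
    simp only [Finset.sum_insert hT]
    rw [hadd, shapleyValue_add, ih, hunanimity]
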